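/- arXiv:1903.04106 — 2 statements merged into one kernel-verified Lean document; each statement's English description precedes it below -/
import Mathlib

section
/- Let r, q ∈ ℝ, σ > 0, α, β, p ∈ ℝ, K > 0, τ > 0, τ₁ ∈ ℝ, τ₁' > 0 and X > 0. Then (e^{−rτ} / (σ√(2πτ))) · ∫₀^∞ z^{β−1} · N( [ln(z^p/K) + (r − q − σ²/2 + ασ²)τ₁] / (σ√τ₁') ) · exp( −(ln(X/z) + (r − q − σ²/2)τ)² / (2σ²τ) ) dz = X^β e^{μ(β)τ} N(d₁), where d₁ = [ln(X^p/K) + (r − q − σ²/2)(pτ + τ₁) + σ²(pβτ + ατ₁)] / (σ√(p²τ + τ₁')). -/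
open MeasureTheory

/-- `μ(β) = (β−1)r − βq + (σ²/2)(β²−β)` -/
noncomputable def mu (r q σ β : ℝ) : ℝ := (β - 1) * r - β * q + σ ^ 2 / 2 * (β ^ 2 - β)

/-- The standard normal cumulative distribution function. -/
noncomputable def normCDF (d : ℝ) : ℝ :=
  (Real.sqrt (2 * Real.pi))⁻¹ * ∫ y in Set.Iio d, Real.exp (-y ^ 2 / 2)

open ProbabilityTheory in
lemma normCDF_eq_gaussianReal_Iio (d : ℝ) :
    normCDF d = (gaussianReal 0 1).real (Set.Iio d) := by
  rw [measureReal_def, gaussianReal_apply_eq_integral 0 one_ne_zero, ENNReal.toReal_ofReal]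
  · simp [normCDF, gaussianPDFReal, integral_const_mul]
  · exact integral_nonneg fun x ↦ gaussianPDFReal_nonneg _ _ x

open ProbabilityTheory in
lemma gaussianReal_zero_Iio {v : NNReal} {s : ℝ} (hs : 0 < s) (hv : (v : ℝ) = s ^ 2) (a : ℝ) :
    (gaussianReal 0 v).real (Set.Iio a) = normCDF (a / s) := by
  have hmap : gaussianReal 0 v = (gaussianReal 0 1).map (s * ·) := by
    rw [gaussianReal_map_const_mul]
    congr 1
    · simp
    · ext
      simp [hv]
  rw [hmap, map_measureReal_apply (by fun_prop) measurableSet_Iio, normCDF_eq_gaussianReal_Iio]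
  congr 1
  ext x
  simp [lt_div_iff₀' hs]

open ProbabilityTheory in
/-- The mean of `Φ (a + b Z)` for a standard normal variable `Z`. -/
lemma integral_normCDF_gaussianReal (a b : ℝ) :
    ∫ x, normCDF (a + b * x) ∂(gaussianReal 0 1) = normCDF (a / √(1 + b ^ 2)) := by
  have hs : (0 : ℝ) < √(1 + b ^ 2) := by positivity
  have hconv : (gaussianReal 0 1).map ((-b) * ·) ∗ gaussianReal 0 1
      = gaussianReal 0 (.mk (1 + b ^ 2) (by positivity)) := by
    rw [gaussianReal_map_const_mul, gaussianReal_conv_gaussianReal]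
    congr 1
    · simp
    · ext
      simp [add_comm]
  rw [← gaussianReal_zero_Iio (v := .mk (1 + b ^ 2) (by positivity)) hs
      (Real.sq_sqrt (by positivity : 0 ≤ 1 + b ^ 2)).symm a, ← hconv,
    measureReal_def, Measure.conv, Measure.map_apply (by fun_prop) measurableSet_Iio,
    Measure.prod_apply (measurableSet_Iio.preimage (by fun_prop)),
    lintegral_map (measurable_measure_prodMk_left (measurableSet_Iio.preimage (by fun_prop)))
      (by fun_prop)]
  have hset (x : ℝ) :
      Prod.mk (-b * x) ⁻¹' ((fun y : ℝ × ℝ ↦ y.1 + y.2) ⁻¹' Set.Iio a)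
        = Set.Iio (a + b * x) := by
    ext y
    simp only [Set.mem_preimage, Set.mem_Iio]
    constructor <;> intro h <;> linarith
  simp_rw [hset, normCDF_eq_gaussianReal_Iio, measureReal_def]
  refine integral_toReal ?_ (.of_forall fun x ↦ measure_lt_top _ _)
  have hmono : Monotone fun x : ℝ ↦ gaussianReal 0 1 (Set.Iio x) :=
    fun x y h ↦ measure_mono (Set.Iio_subset_Iio h)
  exact (hmono.measurable.comp (by fun_prop : Measurable fun x : ℝ ↦ a + b * x)).aemeasurable

open ProbabilityTheory in
lemma integral_normCDF_mul_exp (a b : ℝ) :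
    ∫ x, normCDF (a + b * x) * Real.exp (-x ^ 2 / 2)
      = √(2 * Real.pi) * normCDF (a / √(1 + b ^ 2)) := by
  have hpi : √(2 * Real.pi) ≠ 0 := by positivity
  rw [← integral_normCDF_gaussianReal, integral_gaussianReal_eq_integral_smul one_ne_zero,
    ← integral_const_mul]
  congr 1
  ext x
  simp only [gaussianPDFReal, smul_eq_mul, NNReal.coe_one, mul_one, sub_zero]
  field_simp

lemma integral_Ioi_eq_integral_exp_affine (A : ℝ) {s : ℝ} (hs : 0 < s) (g : ℝ → ℝ) :
    ∫ z in Set.Ioi (0 : ℝ), g z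
      = ∫ x, s * Real.exp (A + s * x) * g (Real.exp (A + s * x)) := by
  have himage : (fun x : ℝ ↦ Real.exp (A + s * x)) '' Set.univ = Set.Ioi 0 := by
    ext z
    simp only [Set.image_univ, Set.mem_range, Set.mem_Ioi]
    constructor
    · rintro ⟨x, rfl⟩
      positivity
    · intro hz
      refine ⟨(Real.log z - A) / s, ?_⟩
      rw [mul_div_cancel₀ _ hs.ne', add_sub_cancel, Real.exp_log hz]
  have hderiv (x : ℝ) : HasDerivAt (fun x : ℝ ↦ Real.exp (A + s * x))
      (s * Real.exp (A + s * x)) x := by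
    have h := (((hasDerivAt_id x).const_mul s).const_add A).exp
    simpa [mul_comm] using h
  have hinj : Set.InjOn (fun x : ℝ ↦ Real.exp (A + s * x)) Set.univ := fun x _ y _ h ↦ by
    simpa [hs.ne'] using h
  rw [← himage, integral_image_eq_integral_abs_deriv_smul MeasurableSet.univ
    (fun x _ ↦ (hderiv x).hasDerivWithinAt) hinj g, setIntegral_univ]
  congr 1
  ext x
  rw [abs_of_pos (by positivity), smul_eq_mul]

/-- **Theorem 3 (integral form).** The pricing formula for the power normal distribution
standard option, whose payoff is a power function times a normal CDF of a logarithm. -/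
theorem power_normal_distribution_option_price (r q σ α β p K τ τ₁ τ₁' X : ℝ)
    (hσ : 0 < σ) (hK : 0 < K) (hτ : 0 < τ) (hτ₁' : 0 < τ₁') (hX : 0 < X) :
    Real.exp (-(r * τ)) / (σ * Real.sqrt (2 * Real.pi * τ)) *
      ∫ z in Set.Ioi (0 : ℝ),
        z ^ (β - 1) *
          normCDF ((Real.log (z ^ p / K) + (r - q - σ ^ 2 / 2 + α * σ ^ 2) * τ₁) /
            (σ * Real.sqrt τ₁')) *
          Real.exp (-(Real.log (X / z) + (r - q - σ ^ 2 / 2) * τ) ^ 2 / (2 * σ ^ 2 * τ))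
      = X ^ β * Real.exp (mu r q σ β * τ) *
          normCDF ((Real.log (X ^ p / K) + (r - q - σ ^ 2 / 2) * (p * τ + τ₁)
              + σ ^ 2 * (p * β * τ + α * τ₁)) /
            (σ * Real.sqrt (p ^ 2 * τ + τ₁'))) := by
  obtain ⟨L, rfl⟩ : ∃ L, X = Real.exp L := ⟨Real.log X, (Real.exp_log hX).symm⟩
  have hst : 0 < √τ := Real.sqrt_pos.2 hτ
  have hst' : 0 < √τ₁' := Real.sqrt_pos.2 hτ₁'
  have hτsq : √τ ^ 2 = τ := Real.sq_sqrt hτ.le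
  have hτsq' : √τ₁' ^ 2 = τ₁' := Real.sq_sqrt hτ₁'.le
  have hs : 0 < σ * √τ := mul_pos hσ hst
  set m := r - q - σ ^ 2 / 2 with hm
  set c := p * (L + m * τ + β * σ ^ 2 * τ) - Real.log K + (m + α * σ ^ 2) * τ₁ with hc
  have hlog (y : ℝ) : Real.log (Real.exp y ^ p / K) = p * y - Real.log K := by
    rw [Real.log_div (by positivity) hK.ne', Real.log_rpow (by positivity), Real.log_exp]
  rw [integral_Ioi_eq_integral_exp_affine (L + m * τ + β * σ ^ 2 * τ) hs]
  have hpoint (x : ℝ) :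
      σ * √τ * Real.exp (L + m * τ + β * σ ^ 2 * τ + σ * √τ * x) *
        (Real.exp (L + m * τ + β * σ ^ 2 * τ + σ * √τ * x) ^ (β - 1) *
          normCDF ((Real.log (Real.exp (L + m * τ + β * σ ^ 2 * τ + σ * √τ * x) ^ p / K)
            + (m + α * σ ^ 2) * τ₁) / (σ * √τ₁')) *
          Real.exp (-(Real.log (Real.exp L /
            Real.exp (L + m * τ + β * σ ^ 2 * τ + σ * √τ * x)) + m * τ) ^ 2
              / (2 * σ ^ 2 * τ)))
      = σ * √τ * Real.exp (β * L + β * m * τ + β ^ 2 * σ ^ 2 * τ / 2) *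
        (normCDF (c / (σ * √τ₁') + p * √τ / √τ₁' * x) * Real.exp (-x ^ 2 / 2)) := by
    have harg : (Real.log (Real.exp (L + m * τ + β * σ ^ 2 * τ + σ * √τ * x) ^ p / K)
        + (m + α * σ ^ 2) * τ₁) / (σ * √τ₁') = c / (σ * √τ₁') + p * √τ / √τ₁' * x := by
      rw [hlog, hc]
      field_simp
      ring
    have hexponent : (L + m * τ + β * σ ^ 2 * τ + σ * √τ * x)
        + (L + m * τ + β * σ ^ 2 * τ + σ * √τ * x) * (β - 1)
        + -(L - (L + m * τ + β * σ ^ 2 * τ + σ * √τ * x) + m * τ) ^ 2 / (2 * σ ^ 2 * τ)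
        = (β * L + β * m * τ + β ^ 2 * σ ^ 2 * τ / 2) + -x ^ 2 / 2 := by
      have hsq : (L - (L + m * τ + β * σ ^ 2 * τ + σ * √τ * x) + m * τ) ^ 2
          = σ ^ 2 * τ * (β ^ 2 * σ ^ 2 * τ + 2 * β * σ * √τ * x + x ^ 2) := by
        linear_combination (σ ^ 2 * x ^ 2) * hτsq
      rw [hsq]
      field_simp
      ring
    have hexp := congrArg Real.exp hexponent
    simp only [Real.exp_add _ (-_ / _)] at hexp
    rw [Real.exp_add (L + m * τ + β * σ ^ 2 * τ + σ * √τ * x), Real.exp_mul] at hexp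
    rw [harg, ← Real.exp_sub, Real.log_exp]
    linear_combination
      (σ * √τ * normCDF (c / (σ * √τ₁') + p * √τ / √τ₁' * x)) * hexp
  have hden : σ * √(p ^ 2 * τ + τ₁') = σ * √τ₁' * √(1 + (p * √τ / √τ₁') ^ 2) := by
    rw [mul_assoc, ← Real.sqrt_mul hτ₁'.le, div_pow, mul_pow, hτsq, hτsq']
    congr 2
    field_simp
    ring
  have hnum : Real.log (Real.exp L ^ p / K) + m * (p * τ + τ₁)
      + σ ^ 2 * (p * β * τ + α * τ₁) = c := by
    rw [hlog, hc]
    ring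
  have hfactor : Real.exp L ^ β * Real.exp (mu r q σ β * τ)
      = Real.exp (-(r * τ)) * Real.exp (β * L + β * m * τ + β ^ 2 * σ ^ 2 * τ / 2) := by
    rw [← Real.exp_mul, ← Real.exp_add, ← Real.exp_add, mu, hm]
    ring_nf
  simp_rw [hpoint]
  rw [integral_const_mul, integral_normCDF_mul_exp, hnum, hden, hfactor, div_div,
    Real.sqrt_mul (by positivity) τ]
  have hpi : √(2 * Real.pi) ≠ 0 := by positivity
  field_simp
end

section
/- Let r, q ∈ ℝ, σ > 0, α, β, p ∈ ℝ, K > 0, τ₁ ∈ ℝ, τ₁' > 0 and T ∈ ℝ. Define, for X > 0 and t ≤ T, V(X,t) = X^β e^{μ(β)(T−t)} N(D(X, T−t)) where D(X,τ) = [ln(X^p/K) + (r − q − σ²/2)(pτ + τ₁) + σ²(pβτ + ατ₁)] / (σ√(p²τ + τ₁')). Then for all X > 0 and t < T, ∂V/∂t + (σ²/2)X² ∂²V/∂X² + (r−q)X ∂V/∂X − rV = 0, and V(X,T) = X^β · N( [ln(X^p/K) + (r − q − σ²/2 + ασ²)τ₁] / (σ√τ₁') ). -/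
open MeasureTheory

/-- The argument of the normal CDF in the power normal distribution option price. -/
noncomputable def Darg (r q σ α β p K τ₁ τ₁' : ℝ) (X τ : ℝ) : ℝ :=
  (Real.log (X ^ p / K) + (r - q - σ ^ 2 / 2) * (p * τ + τ₁)
      + σ ^ 2 * (p * β * τ + α * τ₁)) /
    (σ * Real.sqrt (p ^ 2 * τ + τ₁'))

/-- The standard normal density. -/
noncomputable def normPDF (d : ℝ) : ℝ :=
  (Real.sqrt (2 * Real.pi))⁻¹ * Real.exp (-d ^ 2 / 2)

lemma hasDerivAt_normPDF (d : ℝ) : HasDerivAt normPDF (-d * normPDF d) d := by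
  have h : HasDerivAt (fun y : ℝ => -y ^ 2 / 2) (-d) d := by
    refine ((hasDerivAt_pow 2 d).neg.div_const 2).congr_deriv ?_
    norm_num
    ring
  refine (h.exp.const_mul (Real.sqrt (2 * Real.pi))⁻¹).congr_deriv ?_
  rw [normPDF]
  ring

lemma hasDerivAt_normCDF (d : ℝ) : HasDerivAt normCDF (normPDF d) d := by
  have hint : Integrable (fun y : ℝ => Real.exp (-y ^ 2 / 2)) := by
    convert integrable_exp_neg_mul_sq (b := 1 / 2) (by norm_num) using 3
    ring
  have hc : Continuous (fun y : ℝ => Real.exp (-y ^ 2 / 2)) := by fun_prop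
  have h := ((intervalIntegral.integral_hasDerivAt_right
    (hc.intervalIntegrable 0 d) (hc.stronglyMeasurableAtFilter _ _) hc.continuousAt).add_const
      (∫ y in Set.Iic 0, Real.exp (-y ^ 2 / 2))).const_mul (Real.sqrt (2 * Real.pi))⁻¹
  refine h.congr_of_eventuallyEq (.of_forall fun u => ?_)
  simp only
  rw [normCDF, ← integral_Iic_eq_integral_Iio,
    ← intervalIntegral.integral_Iic_sub_Iic hint.integrableOn hint.integrableOn, sub_add_cancel]

lemma Real.hasDerivAt_rpow_div_self {X : ℝ} (hX : 0 < X) (β : ℝ) :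
    HasDerivAt (fun z : ℝ => z ^ β) (X ^ β * β / X) X := by
  refine (Real.hasDerivAt_rpow_const (p := β) (Or.inl hX.ne')).congr_deriv ?_
  rw [Real.rpow_sub_one hX.ne']
  ring

section Darg

variable (r q σ α β p K τ₁ τ₁' : ℝ)

lemma hasDerivAt_Darg_spot {X : ℝ} (τ : ℝ) (hK : 0 < K) (hX : 0 < X) :
    HasDerivAt (fun z => Darg r q σ α β p K τ₁ τ₁' z τ)
      (p / (σ * Real.sqrt (p ^ 2 * τ + τ₁')) / X) X := by
  have h := (((((Real.hasDerivAt_rpow_div_self hX p).div_const K).log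
    (div_pos (Real.rpow_pos_of_pos hX p) hK).ne').add_const
      ((r - q - σ ^ 2 / 2) * (p * τ + τ₁))).add_const
      (σ ^ 2 * (p * β * τ + α * τ₁))).div_const (σ * Real.sqrt (p ^ 2 * τ + τ₁'))
  refine h.congr_deriv ?_
  have := (Real.rpow_pos_of_pos hX p).ne'
  field_simp

lemma hasDerivAt_Darg_time (X : ℝ) {τ : ℝ} (hσ : 0 < σ) (hτ : 0 < p ^ 2 * τ + τ₁') :
    HasDerivAt (fun s => Darg r q σ α β p K τ₁ τ₁' X s)
      (p * (r - q - σ ^ 2 / 2 + σ ^ 2 * β) / (σ * Real.sqrt (p ^ 2 * τ + τ₁'))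
        - Darg r q σ α β p K τ₁ τ₁' X τ * p ^ 2 / (2 * Real.sqrt (p ^ 2 * τ + τ₁') ^ 2)) τ := by
  have hs := Real.sqrt_pos.2 hτ
  have hid := hasDerivAt_id' τ
  have hnum := ((((hid.const_mul p).add_const τ₁).const_mul (r - q - σ ^ 2 / 2)).const_add
    (Real.log (X ^ p / K))).add (((hid.const_mul (p * β)).add_const (α * τ₁)).const_mul (σ ^ 2))
  have hden := (((hid.const_mul (p ^ 2)).add_const τ₁').sqrt hτ.ne').const_mul σ
  refine (hnum.div hden (by positivity)).congr_deriv ?_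
  simp only [Darg, Pi.add_apply]
  field_simp

end Darg

/-- **Theorem 3 (PDE form).** `V(X,t) = X^β e^{μ(β)(T−t)} N(D(X,T−t))` solves the
Black–Scholes terminal-value problem whose terminal payoff is `X^β` times a normal CDF. -/
theorem power_normal_distribution_option_solves_BS (r q σ α β p K τ₁ τ₁' T : ℝ)
    (hσ : 0 < σ) (hK : 0 < K) (hτ₁' : 0 < τ₁')
    (V : ℝ → ℝ → ℝ)
    (hV : ∀ X t : ℝ, 0 < X → t ≤ T →
      V X t = X ^ β * Real.exp (mu r q σ β * (T - t)) *
        normCDF (Darg r q σ α β p K τ₁ τ₁' X (T - t))) :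
    (∀ X t : ℝ, 0 < X → t < T →
      deriv (fun u => V X u) t
        + σ ^ 2 / 2 * X ^ 2 * deriv (fun y => deriv (fun z => V z t) y) X
        + (r - q) * X * deriv (fun y => V y t) X
        - r * V X t = 0) ∧
    (∀ X : ℝ, 0 < X →
      V X T = X ^ β *
        normCDF ((Real.log (X ^ p / K) + (r - q - σ ^ 2 / 2 + α * σ ^ 2) * τ₁) /
          (σ * Real.sqrt τ₁'))) := by
  refine ⟨fun X t hX ht => ?_, fun X hX => ?_⟩
  · have hsq : 0 < p ^ 2 * (T - t) + τ₁' := by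
      have := sub_pos.2 ht
      positivity
    have hs := Real.sqrt_pos.2 hsq
    set s := Real.sqrt (p ^ 2 * (T - t) + τ₁') with hs_def
    set E := Real.exp (mu r q σ β * (T - t)) with hE
    let D : ℝ → ℝ := fun z => Darg r q σ α β p K τ₁ τ₁' z (T - t)
    have hD : ∀ z, 0 < z → HasDerivAt D (p / (σ * s) / z) z := fun z hz =>
      hasDerivAt_Darg_spot r q σ α β p K τ₁ τ₁' (T - t) hK hz
    have hN : ∀ z, 0 < z →
        HasDerivAt (fun y => normCDF (D y)) (normPDF (D z) * (p / (σ * s) / z)) z :=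
      fun z hz => (hasDerivAt_normCDF (D z)).comp z (hD z hz)
    have hφ : HasDerivAt (fun y => normPDF (D y))
        (-D X * normPDF (D X) * (p / (σ * s) / X)) X :=
      (hasDerivAt_normPDF (D X)).comp X (hD X hX)
    have hVX : ∀ z, 0 < z → deriv (fun y => V y t) z =
        z ^ β * E / z * (β * normCDF (D z) + p / (σ * s) * normPDF (D z)) := by
      intro z hz
      have h := ((Real.hasDerivAt_rpow_div_self hz β).mul_const E).mul (hN z hz)
      have heq : (fun y => V y t) =ᶠ[nhds z] (fun y => y ^ β * E) * fun y => normCDF (D y) := by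
        filter_upwards [lt_mem_nhds hz] with y hy using hV y t hy ht.le
      rw [(h.congr_of_eventuallyEq heq).deriv]
      ring
    have hVXX : deriv (fun y => deriv (fun z => V z t) y) X =
        X ^ β * E / X ^ 2 * (β * (β - 1) * normCDF (D X)
          + (2 * β - 1) * (p / (σ * s)) * normPDF (D X)
          - D X * (p / (σ * s)) ^ 2 * normPDF (D X)) := by
      have h := (((Real.hasDerivAt_rpow_div_self hX β).mul_const E).div (hasDerivAt_id' X)
        hX.ne').mul (((hN X hX).const_mul β).add (hφ.const_mul (p / (σ * s))))
      have heq := Filter.Eventually.mono (lt_mem_nhds hX) hVX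
      rw [(h.congr_of_eventuallyEq heq).deriv]
      simp only [Pi.add_apply, Pi.div_apply]
      field_simp
      ring
    have hVt : deriv (fun u => V X u) t = -(X ^ β * E * (mu r q σ β * normCDF (D X)
        + normPDF (D X) * (p * (r - q - σ ^ 2 / 2 + σ ^ 2 * β) / (σ * s)
          - D X * p ^ 2 / (2 * s ^ 2)))) := by
      have hτ : HasDerivAt (fun u => T - u) (-1) t := (hasDerivAt_id' t).const_sub T
      have hDt := (hasDerivAt_Darg_time r q σ α β p K τ₁ τ₁' X hσ hsq).comp t hτ
      have h := ((hτ.const_mul (mu r q σ β)).exp.const_mul (X ^ β)).mul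
        ((hasDerivAt_normCDF (D X)).comp t hDt)
      have heq : (fun u => V X u) =ᶠ[nhds t] _ :=
        Filter.Eventually.mono (gt_mem_nhds ht) fun u hu => hV X u hX hu.le
      rw [(h.congr_of_eventuallyEq heq).deriv]
      simp only [Function.comp_apply, ← hs_def, ← hE]
      ring
    rw [hVt, hVXX, hVX X hX, hV X t hX ht.le]
    change _ - r * (X ^ β * E * normCDF (D X)) = 0
    unfold mu
    field_simp
    ring
  · rw [hV X T hX le_rfl]
    simp only [Darg, sub_self, mul_zero, zero_add, Real.exp_zero, mul_one]
    congr 3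
    ring
end
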